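/- 2×2×2 hexagon lemma, matrix form: the boundary word of the 2 by 2 by 2 hexagonal region evaluates to the identity matrix, X·y·Z·Z·x·Y·Y·z·X = I. (The 2 by 2 by 2 region is signed-tilable by only bones and snakes, and hence its boundary contributes the identity matrix to any path product.) -/

import Mathlib

open Matrix

/-- `ω = exp(2πi/12)`, a primitive 12th root of unity. -/
noncomputable def ω : ℂ := Complex.exp (2 * Real.pi * Complex.I / 12)

/-- The SL₂(ℂ) connection matrix on northeast edges. -/
noncomputable def α : Matrix (Fin 2) (Fin 2) ℂ := !![ω^7, 0; 0, ω^5]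

/-- The SL₂(ℂ) connection matrix on northwest edges. -/
noncomputable def β : Matrix (Fin 2) (Fin 2) ℂ := !![ω^7, ω^3; 0, ω^5]

/-- The SL₂(ℂ) connection matrix on horizontal edges. -/
noncomputable def γ : Matrix (Fin 2) (Fin 2) ℂ := !![ω^5, 0; ω^3, ω^7]

/-- The length-two move `X = β·α`. -/
noncomputable def X : Matrix (Fin 2) (Fin 2) ℂ := β * α

/-- The length-two move `Y = α⁻¹·γ`. -/
noncomputable def Y : Matrix (Fin 2) (Fin 2) ℂ := α⁻¹ * γ

/-- The length-two move `Z = γ⁻¹·β⁻¹`. -/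
noncomputable def Z : Matrix (Fin 2) (Fin 2) ℂ := γ⁻¹ * β⁻¹

/-- `x = X⁻¹`. -/
noncomputable def x : Matrix (Fin 2) (Fin 2) ℂ := X⁻¹

/-- `y = Y⁻¹`. -/
noncomputable def y : Matrix (Fin 2) (Fin 2) ℂ := Y⁻¹

/-- `z = Z⁻¹`. -/
noncomputable def z : Matrix (Fin 2) (Fin 2) ℂ := Z⁻¹

theorem ω_pow_four : ω ^ 4 = ω ^ 2 - 1 := by
  have h : ω ^ 2 = 1 / 2 + (√3 / 2 : ℝ) * Complex.I := by
    have e : ω ^ 2 = Complex.exp ((Real.pi / 3 : ℝ) * Complex.I) := by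
      rw [ω, ← Complex.exp_nat_mul]
      congr 1
      push_cast
      ring
    rw [e, Complex.exp_mul_I, ← Complex.ofReal_cos, ← Complex.ofReal_sin,
      Real.cos_pi_div_three, Real.sin_pi_div_three]
    push_cast
    ring
  have h3 : ((√3 : ℝ) : ℂ) ^ 2 = 3 := by
    norm_cast
    simp
  rw [show ω ^ 4 = (ω ^ 2) ^ 2 by ring, h]
  push_cast
  linear_combination (Complex.I ^ 2 / 4) * h3 + (3 / 4) * Complex.I_sq

theorem α_inv : α⁻¹ = !![ω ^ 5, 0; 0, ω ^ 7] := by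
  apply Matrix.inv_eq_right_inv
  ext i j
  fin_cases i <;> fin_cases j <;> simp [α] <;> grind [ω_pow_four]

theorem β_inv : β⁻¹ = !![ω ^ 5, -ω ^ 3; 0, ω ^ 7] := by
  apply Matrix.inv_eq_right_inv
  ext i j
  fin_cases i <;> fin_cases j <;> simp [β] <;> grind [ω_pow_four]

theorem γ_inv : γ⁻¹ = !![ω ^ 7, 0; -ω ^ 3, ω ^ 5] := by
  apply Matrix.inv_eq_right_inv
  ext i j
  fin_cases i <;> fin_cases j <;> simp [γ] <;> grind [ω_pow_four]

theorem X_eq : X = !![ω ^ 2, -ω ^ 2; 0, 1 - ω ^ 2] := by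
  ext i j
  fin_cases i <;> fin_cases j <;> simp [X, α, β] <;> grind [ω_pow_four]

theorem Y_eq : Y = !![1 - ω ^ 2, 0; 1 - ω ^ 2, ω ^ 2] := by
  ext i j
  fin_cases i <;> fin_cases j <;> simp [Y, α_inv, γ] <;> grind [ω_pow_four]

theorem Z_eq : Z = !![1, ω ^ 2 - 1; ω ^ 2, 0] := by
  ext i j
  fin_cases i <;> fin_cases j <;> simp [Z, γ_inv, β_inv] <;> grind [ω_pow_four]

theorem x_eq : x = !![1 - ω ^ 2, ω ^ 2; 0, ω ^ 2] := by
  rw [x, X_eq]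
  apply Matrix.inv_eq_right_inv
  ext i j
  fin_cases i <;> fin_cases j <;> simp <;> grind [ω_pow_four]

theorem y_eq : y = !![ω ^ 2, 0; ω ^ 2 - 1, 1 - ω ^ 2] := by
  rw [y, Y_eq]
  apply Matrix.inv_eq_right_inv
  ext i j
  fin_cases i <;> fin_cases j <;> simp <;> grind [ω_pow_four]

theorem z_eq : z = !![0, 1 - ω ^ 2; -ω ^ 2, 1] := by
  rw [z, Z_eq]
  apply Matrix.inv_eq_right_inv
  ext i j
  fin_cases i <;> fin_cases j <;> simp <;> grind [ω_pow_four]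

/-- 2×2×2 hexagon lemma, matrix form: the boundary word of the 2 by 2 by 2 hexagonal
region evaluates to the identity matrix. -/
theorem two_by_two_by_two_boundary_eq_one :
    X * y * Z * Z * x * Y * Y * z * X = (1 : Matrix (Fin 2) (Fin 2) ℂ) := by
  rw [X_eq, Y_eq, Z_eq, x_eq, y_eq, z_eq]
  ext i j
  fin_cases i <;> fin_cases j <;> simp <;> grind [ω_pow_four]
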